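/- Let d ≥ 1, let α ∈ (0,2), let c_{d,α} = 2^α Γ((d+α)/2) / (π^{d/2} |Γ(−α/2)|), and define K_α(z) = c_{d,α} Σ_{k∈ℤ^d} |z − 2πk|^{−(d+α)} for z ∉ 2πℤ^d. Let p ≥ 4 be an even integer and let θ : ℝ^d → ℝ be a smooth 2πℤ^d-periodic function with ∫_{[−π,π]^d} θ = 0. Then ∫_{[−π,π]^d} ∫_{[−π,π]^d} f_p(θ(x), θ(y)) K_α(x−y) dy dx ≥ ((p−2) c_{d,α} (2π)^d / (2 (2π + 2π√d)^{d+α})) · ∫_{[−π,π]^d} |θ(x)|^p dx, where f_p(a,b) = p(a^{p−1} − b^{p−1})(a − b) − 2(a^{p/2} − b^{p/2})². -/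

import Mathlib

open Real MeasureTheory

/-- The normalization constant `c_{d,α} = 2^α Γ((d+α)/2) / (π^{d/2} |Γ(−α/2)|)`. -/
noncomputable def fracLapConstD (d : ℕ) (α : ℝ) : ℝ :=
  2 ^ α * Real.Gamma (((d : ℝ) + α) / 2) / (π ^ ((d : ℝ) / 2) * |Real.Gamma (-(α / 2))|)

/-- The periodic kernel `K_α(z) = c_{d,α} Σ_{k∈ℤ^d} |z − 2πk|^{−(d+α)}`. -/
noncomputable def periodicKernelD (d : ℕ) (α : ℝ) (z : EuclideanSpace ℝ (Fin d)) : ℝ :=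
  fracLapConstD d α * ∑' k : Fin d → ℤ,
    ‖z - (EuclideanSpace.equiv (Fin d) ℝ).symm (fun i => 2 * π * (k i : ℝ))‖ ^ (-((d : ℝ) + α))

/-- The period cell `[−π,π]^d`. -/
def periodCell (d : ℕ) : Set (EuclideanSpace ℝ (Fin d)) :=
  {x | ∀ i, x i ∈ Set.Icc (-π) π}

/-- `f_p(a,b) = p(a^{p−1} − b^{p−1})(a − b) − 2(a^{p/2} − b^{p/2})²`. -/
noncomputable def fp (p : ℕ) (a b : ℝ) : ℝ :=
  (p : ℝ) * (a ^ (p - 1) - b ^ (p - 1)) * (a - b) - 2 * (a ^ (p / 2) - b ^ (p / 2)) ^ 2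


lemma aux_g_nonneg (a b : ℝ) (hab : 0 ≤ a * b) (n : ℕ) :
    0 ≤ (n : ℝ) * (a ^ (2 * n + 2) + b ^ (2 * n + 2)) + 2 * (a ^ (n + 1) * b ^ (n + 1))
      - (n + 1) * (a ^ (2 * n + 1) * b + a * b ^ (2 * n + 1)) := by
  induction n with
  | zero => simp; ring_nf; rfl
  | succ n ih =>
    have h1 := mul_nonneg hab ih
    have ha : 0 ≤ a ^ (2 * n + 2) := by
      rw [show 2 * n + 2 = 2 * (n + 1) by ring, pow_mul]; positivity
    have hb : 0 ≤ b ^ (2 * n + 2) := by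
      rw [show 2 * n + 2 = 2 * (n + 1) by ring, pow_mul]; positivity
    have h2 : 0 ≤ ((n : ℝ) + 1) * ((a - b) ^ 2 * (a ^ (2 * n + 2) + b ^ (2 * n + 2))) := by
      positivity
    refine (add_nonneg h1 h2).trans_eq ?_
    push_cast
    ring

lemma fp_expand (m : ℕ) (a b : ℝ) : fp (2 * (m + 2)) a b =
    (2 * (m : ℝ) + 2) * (a ^ (2 * (m + 2)) + b ^ (2 * (m + 2))) + 4 * (a ^ (m + 2) * b ^ (m + 2))
      - 2 * ((m : ℝ) + 2) * (a ^ (2 * m + 3) * b + a * b ^ (2 * m + 3)) := by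
  unfold fp
  rw [show 2 * (m + 2) - 1 = 2 * m + 3 by omega, show 2 * (m + 2) / 2 = m + 2 by omega]
  push_cast
  ring

lemma fp_nonneg' (m : ℕ) (a b : ℝ) : 0 ≤ fp (2 * (m + 2)) a b := by
  rw [fp_expand]
  rcases le_total 0 (a * b) with hab | hab
  · have := aux_g_nonneg a b hab (m + 1)
    push_cast at this
    rw [show 2 * (m + 1) + 2 = 2 * (m + 2) by ring, show 2 * (m + 1) + 1 = 2 * m + 3 by ring,
      show m + 1 + 1 = m + 2 by ring] at this
    linarith
  · have h1 : a ^ (2 * m + 3) * b + a * b ^ (2 * m + 3) ≤ 0 := by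
      have : a ^ (2 * m + 3) * b + a * b ^ (2 * m + 3)
        = (a * b) * ((a ^ (m + 1)) ^ 2 + (b ^ (m + 1)) ^ 2) := by ring
      rw [this]
      exact mul_nonpos_of_nonpos_of_nonneg hab (by positivity)
    have h2 : a ^ (2 * (m + 2)) + b ^ (2 * (m + 2)) = (a ^ (m + 2)) ^ 2 + (b ^ (m + 2)) ^ 2 := by
      ring
    have h3 : 0 ≤ (m : ℝ) := by positivity
    rw [h2]
    have h4 : 0 ≤ (m : ℝ) * ((a ^ (m + 2)) ^ 2 + (b ^ (m + 2)) ^ 2) := by positivity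
    have h5 : 0 ≤ (2 * ((m : ℝ) + 2)) * (-(a ^ (2 * m + 3) * b + a * b ^ (2 * m + 3))) := by
      apply mul_nonneg <;> linarith
    nlinarith [sq_nonneg (a ^ (m + 2) + b ^ (m + 2))]

noncomputable abbrev latV (d : ℕ) (k : Fin d → ℤ) : EuclideanSpace ℝ (Fin d) :=
  (EuclideanSpace.equiv (Fin d) ℝ).symm (fun i => 2 * π * (k i : ℝ))

lemma isCompact_periodCell (d : ℕ) : IsCompact (periodCell d) := by
  have h : periodCell d = (EuclideanSpace.equiv (Fin d) ℝ).toHomeomorph ⁻¹'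
      (Set.univ.pi fun _ => Set.Icc (-π) π) := by
    ext x; simp only [periodCell, Set.mem_preimage, Set.mem_univ_pi, Set.mem_ofPred_eq]; rfl
  rw [h, Homeomorph.isCompact_preimage]
  exact isCompact_univ_pi fun _ => isCompact_Icc

lemma volume_periodCell (d : ℕ) : volume.real (periodCell d) = (2 * π) ^ d := by
  have h : periodCell d = (@WithLp.ofLp 2 (Fin d → ℝ)) ⁻¹'
      (Set.univ.pi fun _ => Set.Icc (-π) π) := by
    ext x; simp only [periodCell, Set.mem_preimage, Set.mem_univ_pi, Set.mem_ofPred_eq]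
  rw [h, Measure.real, (PiLp.volume_preserving_ofLp (Fin d)).measure_preimage
    (MeasurableSet.univ_pi fun _ => measurableSet_Icc).nullMeasurableSet, volume_pi_pi]
  simp [two_mul, Real.pi_pos.le]

lemma exists_shift (d : ℕ) (x : EuclideanSpace ℝ (Fin d)) :
    ∃ k : Fin d → ℤ, x + latV d k ∈ periodCell d := by
  have : ∀ i, ∃ n : ℤ, x i + 2 * π * (n : ℝ) ∈ Set.Icc (-π) π := by
    intro i
    obtain ⟨n, hn, -⟩ := existsUnique_add_zsmul_mem_Ico (Real.two_pi_pos) (x i) (-π)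
    refine ⟨n, ?_⟩
    simp only [zsmul_eq_mul, Set.mem_Ico] at hn
    constructor <;> linarith [hn.1, hn.2]
  choose k hk using this
  exact ⟨k, fun i => by simpa [latV] using hk i⟩

lemma periodic_lipschitz (d : ℕ) (θ : EuclideanSpace ℝ (Fin d) → ℝ)
    (hθ : ContDiff ℝ (⊤ : ℕ∞) θ) (hper : ∀ x k, θ (x + latV d k) = θ x) :
    ∃ L, 0 ≤ L ∧ ∀ x y, |θ x - θ y| ≤ L * ‖x - y‖ := by
  have hcont : Continuous (fderiv ℝ θ) := hθ.continuous_fderiv (by simp)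
  obtain ⟨C, hC⟩ := (isCompact_periodCell d).exists_bound_of_continuousOn hcont.continuousOn
  have hall : ∀ x, ‖fderiv ℝ θ x‖ ≤ C := by
    intro x
    obtain ⟨k, hk⟩ := exists_shift d x
    have h1 : fderiv ℝ θ (x + latV d k) = fderiv ℝ θ x := by
      rw [← fderiv_comp_add_right]
      congr 1
      ext y
      exact hper y k
    rw [← h1]
    exact hC _ hk
  refine ⟨C, (norm_nonneg _).trans (hall 0), fun x y => ?_⟩
  exact convex_univ.norm_image_sub_le_of_norm_fderiv_le (𝕜 := ℝ)
    (fun z _ => (hθ.differentiable (by simp)) z) (fun z _ => hall z) (Set.mem_univ y) (Set.mem_univ x)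

lemma summable_lat (d : ℕ) (r : ℝ) (hr : r < -(d : ℝ)) :
    Summable fun k : Fin d → ℤ => ‖latV d k‖ ^ r := by
  let b := (EuclideanSpace.basisFun (Fin d) ℝ).toBasis
  let L := Submodule.span ℤ (Set.range b)
  let bL : Module.Basis (Fin d) ℤ L := b.restrictScalars ℤ
  have hfin : Module.finrank ℤ L = d := by
    rw [Module.finrank_eq_card_basis bL]; simp
  have h := ZLattice.summable_norm_rpow L r (by rw [hfin]; exact hr)
  have h2 := (bL.equivFun.symm.toEquiv.summable_iff).2 h
  refine (h2.mul_left ((2 * π) ^ r)).congr fun k => ?_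
  have : latV d k = (2 * π) • ((bL.equivFun.symm k : L) : EuclideanSpace ℝ (Fin d)) := by
    ext i
    have hb : ∀ j, ((bL j : L) : EuclideanSpace ℝ (Fin d)) = EuclideanSpace.single j 1 := by
      intro j
      have := Module.Basis.restrictScalars_apply ℤ b j
      rw [this]; simp [b]
    simp [latV, Module.Basis.equivFun_symm_apply, hb, Pi.single_apply]
  rw [this, norm_smul, Real.norm_of_nonneg (by positivity : 0 ≤ 2 * π),
    Real.mul_rpow (by positivity : 0 ≤ 2 * π) (norm_nonneg _)]
  rfl

lemma finite_lat (d : ℕ) (R : ℝ) : {k : Fin d → ℤ | ‖latV d k‖ ≤ R}.Finite := by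
  refine (Set.finite_Icc (fun _ => -⌈R⌉) (fun _ => ⌈R⌉)).subset fun k hk => ?_
  have : ∀ i, |(k i : ℝ)| ≤ R := by
    intro i
    have h1 := (PiLp.norm_apply_le (latV d k) i).trans hk
    simp [latV, abs_of_pos Real.pi_pos] at h1
    nlinarith [Real.pi_gt_three, abs_nonneg (k i : ℝ)]
  have h2 : ∀ i, |k i| ≤ ⌈R⌉ := fun i => by
    have := (this i).trans (Int.le_ceil R)
    exact_mod_cast this
  exact ⟨fun i => (abs_le.1 (h2 i)).1, fun i => (abs_le.1 (h2 i)).2⟩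

lemma norm_sub_cell (d : ℕ) {x y : EuclideanSpace ℝ (Fin d)} (hx : x ∈ periodCell d)
    (hy : y ∈ periodCell d) : ‖x - y‖ ≤ 2 * π * √d := by
  rw [EuclideanSpace.norm_eq]
  have h : ∑ i, ‖(x - y) i‖ ^ 2 ≤ (2 * π) ^ 2 * d := by
    calc _ ≤ ∑ i : Fin d, (2 * π) ^ 2 := by
          refine Finset.sum_le_sum fun i _ => ?_
          have h1 := hx i
          have h2 := hy i
          gcongr
          simp only [PiLp.sub_apply, Real.norm_eq_abs]
          rw [abs_le]
          constructor <;> linarith [h1.1, h1.2, h2.1, h2.2]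
      _ = _ := by simp; ring
  refine (Real.sqrt_le_sqrt h).trans_eq ?_
  rw [Real.sqrt_mul (by positivity), Real.sqrt_sq (by positivity)]

lemma integrable_shift_rpow (d : ℕ) (hd : 1 ≤ d) (s : ℝ) (hs : -(d : ℝ) < s)
    (v : EuclideanSpace ℝ (Fin d)) :
    Integrable (fun q : EuclideanSpace ℝ (Fin d) × EuclideanSpace ℝ (Fin d) =>
      ‖q.1 - q.2 - v‖ ^ s)
      ((volume.restrict (periodCell d)).prod (volume.restrict (periodCell d))) := by
  have hm : MeasurableSet (periodCell d) := (isCompact_periodCell d).isClosed.measurableSet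
  have hloc : LocallyIntegrable (fun z : EuclideanSpace ℝ (Fin d) => ‖z‖ ^ s) volume := by
    refine locallyIntegrable_of_norm_le_rpow (C := 1) (α := -s) (by simpa) (by simp; linarith) ?_ ?_
    · refine Filter.Eventually.of_forall fun x => ?_
      simp [abs_of_nonneg (Real.rpow_nonneg (norm_nonneg x) s)]
    · exact (measurable_norm.pow_const s).aestronglyMeasurable
  let B : Set (EuclideanSpace ℝ (Fin d)) := Metric.closedBall 0 (2 * π * √d + ‖v‖)
  have hg0 : Integrable (B.indicator fun z : EuclideanSpace ℝ (Fin d) => ‖z‖ ^ s) volume :=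
    (integrable_indicator_iff measurableSet_closedBall).2
      (hloc.integrableOn_isCompact (isCompact_closedBall _ _))
  have hg := hg0.comp_sub_right v
  have hf : Integrable ((periodCell d).indicator fun _ => (1 : ℝ)) volume :=
    (integrable_indicator_iff hm).2 (integrableOn_const (isCompact_periodCell d).measure_lt_top.ne)
  have h := (hf.convolution_integrand (ContinuousLinearMap.mul ℝ ℝ) hg).integrableOn
    (s := (periodCell d) ×ˢ (periodCell d))
  rw [IntegrableOn, ← Measure.prod_restrict] at h
  refine h.congr ?_
  rw [Measure.prod_restrict]
  filter_upwards [ae_restrict_mem (hm.prod hm)] with q hq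
  have hB : q.1 - q.2 - v ∈ B := by
    simp only [B, mem_closedBall_zero_iff]
    exact (norm_sub_le _ _).trans (by gcongr; exact norm_sub_cell d hq.1 hq.2)
  simp [hq.2, Set.indicator_of_mem hB]

lemma measurable_tsum_aux {β ι : Type*} [MeasurableSpace β] [Countable ι] (f : ι → β → ℝ)
    (hf : ∀ i, Measurable (f i)) (hs : ∀ x, Summable fun i => f i x) :
    Measurable fun x => ∑' i, f i x := by
  refine measurable_of_tendsto_metrizable' (f := fun (t : Finset ι) x => ∑ i ∈ t, f i x)
    Filter.atTop (fun t => Finset.measurable_fun_sum t fun i _ => hf i) ?_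
  rw [tendsto_pi_nhds]
  exact fun x => (hs x).hasSum

lemma far_bound (d : ℕ) (r R : ℝ) (hR : 0 < R) (hr : r < 0) (z : EuclideanSpace ℝ (Fin d)) (hz : ‖z‖ ≤ R)
    (k : Fin d → ℤ) (hk : ¬ ‖latV d k‖ ≤ 2 * R) :
    ‖z - latV d k‖ ^ r ≤ (1 / 2) ^ r * ‖latV d k‖ ^ r := by
  push Not at hk
  have h1 : ‖latV d k‖ - ‖z‖ ≤ ‖z - latV d k‖ := by
    rw [norm_sub_rev]; exact norm_sub_norm_le _ _
  rw [← Real.mul_rpow (by norm_num) (norm_nonneg _)]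
  apply Real.rpow_le_rpow_of_nonpos (by linarith) (by linarith) hr.le

lemma summable_shift (d : ℕ) (r : ℝ) (hr : r < -(d : ℝ)) (z : EuclideanSpace ℝ (Fin d)) :
    Summable fun k : Fin d → ℤ => ‖z - latV d k‖ ^ r := by
  have hr0 : r < 0 := hr.trans_le (by simp)
  refine Summable.of_norm_bounded_eventually ((summable_lat d r hr).mul_left ((1 / 2) ^ r)) ?_
  filter_upwards [(finite_lat d (2 * (‖z‖ + 1))).compl_mem_cofinite] with k hk
  rw [Real.norm_of_nonneg (by positivity)]
  exact far_bound d r (‖z‖ + 1) (by positivity) hr0 z (by linarith) k hk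

lemma const_nonneg (d : ℕ) (α : ℝ) (hα : α ∈ Set.Ioo (0 : ℝ) 2) : 0 ≤ fracLapConstD d α := by
  unfold fracLapConstD
  have := hα.1
  have h : 0 < Real.Gamma (((d : ℝ) + α) / 2) := Real.Gamma_pos_of_pos (by positivity)
  positivity

lemma integrable_main (d : ℕ) (hd : 1 ≤ d) (α : ℝ) (hα : α ∈ Set.Ioo (0 : ℝ) 2)
    (G : EuclideanSpace ℝ (Fin d) → EuclideanSpace ℝ (Fin d) → ℝ)
    (hGc : Continuous (fun q : EuclideanSpace ℝ (Fin d) × EuclideanSpace ℝ (Fin d) => G q.1 q.2))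
    (hG0 : ∀ x y, 0 ≤ G x y) (C : ℝ)
    (hGC : ∀ x y k, G x y ≤ C * ‖x - y - latV d k‖ ^ 2) :
    Integrable (fun q : EuclideanSpace ℝ (Fin d) × EuclideanSpace ℝ (Fin d) =>
      G q.1 q.2 * periodicKernelD d α (q.1 - q.2))
      ((volume.restrict (periodCell d)).prod (volume.restrict (periodCell d))) := by
  have hm : MeasurableSet (periodCell d) := (isCompact_periodCell d).isClosed.measurableSet
  have hfm : IsFiniteMeasure (volume.restrict (periodCell d)) :=
    ⟨by simpa using (isCompact_periodCell d).measure_lt_top⟩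
  set r : ℝ := -((d : ℝ) + α) with hr
  have hrd : r < -(d : ℝ) := by have := hα.1; simp only [hr]; linarith
  have hr0 : r < 0 := hrd.trans_le (by simp)
  have hC : 0 ≤ C := by
    let e : EuclideanSpace ℝ (Fin d) := EuclideanSpace.single ⟨0, hd⟩ 1
    have h := (hG0 e 0).trans (hGC e 0 0)
    have h0 : latV d 0 = 0 := by ext i; simp [latV]
    have h1 : ‖e - 0 - latV d 0‖ = 1 := by rw [h0]; simp [e]
    rw [h1] at h; linarith
  let μ := (volume.restrict (periodCell d)).prod (volume.restrict (periodCell d))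
  -- the single terms
  let T : (Fin d → ℤ) → EuclideanSpace ℝ (Fin d) × EuclideanSpace ℝ (Fin d) → ℝ :=
    fun k q => G q.1 q.2 * ‖q.1 - q.2 - latV d k‖ ^ r
  have hTm : ∀ k, Measurable (T k) := fun k =>
    hGc.measurable.mul (Measurable.pow_const (by fun_prop) r)
  have hT0 : ∀ k q, 0 ≤ T k q := fun k q => mul_nonneg (hG0 _ _) (by positivity)
  have hTint : ∀ k, Integrable (T k) μ := by
    intro k
    refine Integrable.mono' ((integrable_shift_rpow d hd (r + 2) (by have := hα.2; simp only [hr]; linarith)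
      (latV d k)).const_mul C) (hTm k).aestronglyMeasurable (Filter.Eventually.of_forall fun q => ?_)
    rw [Real.norm_of_nonneg (hT0 k q)]
    simp only [T]
    rcases (norm_nonneg (q.1 - q.2 - latV d k)).eq_or_lt with h | h
    · rw [← h, Real.zero_rpow hr0.ne]
      simp only [mul_zero]
      positivity
    · calc _ ≤ C * ‖q.1 - q.2 - latV d k‖ ^ 2 * ‖q.1 - q.2 - latV d k‖ ^ r := by
            gcongr; exact hGC _ _ _
        _ = _ := by
            rw [add_comm, Real.rpow_add h, Real.rpow_two]; ring
  have hsum : ∀ q : EuclideanSpace ℝ (Fin d) × EuclideanSpace ℝ (Fin d),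
      Summable fun k => T k q := fun q => (summable_shift d r hrd (q.1 - q.2)).mul_left _
  have heq : ∀ q : EuclideanSpace ℝ (Fin d) × EuclideanSpace ℝ (Fin d),
      G q.1 q.2 * periodicKernelD d α (q.1 - q.2) = fracLapConstD d α * ∑' k, T k q := by
    intro q
    simp only [T, tsum_mul_left, periodicKernelD]
    ring
  simp_rw [heq]
  apply Integrable.const_mul
  have hR : 0 < 2 * π * √d := by
    have : 0 < (d : ℝ) := by exact_mod_cast hd
    have := Real.sqrt_pos.2 this
    positivity
  set R := 2 * π * √d
  let s : Finset (Fin d → ℤ) := (finite_lat d (2 * R)).toFinset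
  let M := C * R ^ 2
  let b : (Fin d → ℤ) → ℝ := fun k => M * ((1 / 2) ^ r * ‖latV d k‖ ^ r)
  have hb : Summable b := ((summable_lat d r hrd).mul_left _).mul_left _
  refine Integrable.mono' (g := fun q => ∑ k ∈ s, T k q + ∑' k, b k)
    ((integrable_finsetSum s fun k _ => hTint k).add (integrable_const _))
    (measurable_tsum_aux T hTm hsum).aestronglyMeasurable ?_
  rw [Measure.prod_restrict]
  filter_upwards [ae_restrict_mem (hm.prod hm)] with q hq
  rw [Real.norm_of_nonneg (tsum_nonneg fun k => hT0 k q)]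
  have hfin : Summable (fun k => if k ∈ s then T k q else 0) :=
    summable_of_ne_finset_zero (s := s) fun k hk => by simp [hk]
  have h1 : ∑ k ∈ s, T k q = ∑' k, if k ∈ s then T k q else 0 := by
    rw [tsum_eq_sum (s := s) (fun k hk => by simp [hk])]
    exact Finset.sum_congr rfl fun k hk => by simp [hk]
  rw [h1, ← hfin.tsum_add hb]
  refine (hsum q).tsum_le_tsum (fun k => ?_) (hfin.add hb)
  have hq' : ‖q.1 - q.2‖ ≤ R := norm_sub_cell d hq.1 hq.2
  by_cases hk : k ∈ s
  · simp only [hk, if_true]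
    have : 0 ≤ b k := by positivity
    linarith
  · simp only [hk, if_false, zero_add]
    have hk' : ¬ ‖latV d k‖ ≤ 2 * R := by simpa [s] using hk
    simp only [T, b]
    have hGM : G q.1 q.2 ≤ M := by
      have h0 : latV d 0 = 0 := by ext i; simp [latV]
      have := hGC q.1 q.2 0
      rw [h0, sub_zero] at this
      refine this.trans ?_
      simp only [M]
      gcongr
    exact mul_le_mul hGM (far_bound d r R hR hr0 _ hq' k hk') (by positivity) (by positivity)

lemma double_integral_bound (d : ℕ) (m : ℕ) (θ : EuclideanSpace ℝ (Fin d) → ℝ)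
    (hθ : Continuous θ) (hmean : (∫ x in periodCell d, θ x) = 0) :
    (2 * (m : ℝ) + 2) * (2 * π) ^ d * 2 * (∫ x in periodCell d, θ x ^ (2 * (m + 2))) ≤
    ∫ x in periodCell d, ∫ y in periodCell d, fp (2 * (m + 2)) (θ x) (θ y) := by
  have hi : ∀ n : ℕ, Integrable (fun x => θ x ^ n) (volume.restrict (periodCell d)) := fun n =>
    ((hθ.pow n).continuousOn).integrableOn_compact (isCompact_periodCell d)
  have hi1 : Integrable θ (volume.restrict (periodCell d)) := by simpa using hi 1
  have hfm : IsFiniteMeasure (volume.restrict (periodCell d)) :=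
    ⟨by simpa using (isCompact_periodCell d).measure_lt_top⟩
  have hin : ∀ x, ∫ y in periodCell d, fp (2 * (m + 2)) (θ x) (θ y) =
      (2 * (m : ℝ) + 2) * ((2 * π) ^ d * θ x ^ (2 * (m + 2))
        + ∫ y in periodCell d, θ y ^ (2 * (m + 2)))
      + 4 * (θ x ^ (m + 2) * ∫ y in periodCell d, θ y ^ (m + 2))
      - 2 * ((m : ℝ) + 2) * (θ x * ∫ y in periodCell d, θ y ^ (2 * m + 3)) := by
    intro x
    simp_rw [fp_expand]
    rw [integral_sub, integral_add, integral_const_mul, integral_add, integral_const_mul,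
      integral_const_mul, integral_const_mul, integral_add, integral_const_mul, integral_const_mul,
      hmean, integral_const]
    · simp [volume_periodCell]
    · exact hi1.const_mul _
    · exact (hi _).const_mul _
    · exact integrable_const _
    · exact hi _
    · exact ((integrable_const _).add (hi _)).const_mul _
    · exact ((hi _).const_mul _).const_mul _
    · exact (((integrable_const _).add (hi _)).const_mul _).add (((hi _).const_mul _).const_mul _)
    · exact ((hi1.const_mul _).add ((hi _).const_mul _)).const_mul _
  simp_rw [hin]
  rw [integral_sub, integral_add, integral_const_mul, integral_add, integral_const_mul,
      integral_const_mul, integral_const_mul, integral_mul_const, integral_mul_const,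
      hmean, integral_const]
  · simp only [measureReal_restrict_apply_univ, volume_periodCell, smul_eq_mul]
    nlinarith [mul_self_nonneg (∫ x in periodCell d, θ x ^ (m + 2))]
  · exact (hi _).const_mul _
  · exact integrable_const _
  · exact (((hi _).const_mul _).add (integrable_const _)).const_mul _
  · exact ((hi _).mul_const _).const_mul _
  · exact ((((hi _).const_mul _).add (integrable_const _)).const_mul _).add
      (((hi _).mul_const _).const_mul _)
  · exact (hi1.mul_const _).const_mul _

/-- For `d ≥ 1`, `α ∈ (0,2)`, an even integer `p ≥ 4`, and a smooth
`2πℤ^d`-periodic zero-mean `θ`, one has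
`∬ f_p(θ(x),θ(y)) K_α(x−y) dy dx
  ≥ ((p−2) c_{d,α} (2π)^d / (2 (2π + 2π√d)^{d+α})) ∫ |θ(x)|^p dx`. -/
theorem fp_kernel_double_integral_lower_bound (d : ℕ) (hd : 1 ≤ d)
    (α : ℝ) (hα : α ∈ Set.Ioo (0 : ℝ) 2)
    (p : ℕ) (hp : 4 ≤ p) (hpeven : Even p)
    (θ : EuclideanSpace ℝ (Fin d) → ℝ) (hθ : ContDiff ℝ (⊤ : ℕ∞) θ)
    (hper : ∀ (x : EuclideanSpace ℝ (Fin d)) (k : Fin d → ℤ),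
      θ (x + (EuclideanSpace.equiv (Fin d) ℝ).symm (fun i => 2 * π * (k i : ℝ))) = θ x)
    (hmean : (∫ x in periodCell d, θ x) = 0) :
    (∫ x in periodCell d, (∫ y in periodCell d, fp p (θ x) (θ y) * periodicKernelD d α (x - y))) ≥
      ((p : ℝ) - 2) * fracLapConstD d α * (2 * π) ^ d /
          (2 * (2 * π + 2 * π * Real.sqrt d) ^ ((d : ℝ) + α)) *
        (∫ x in periodCell d, |θ x| ^ p) := by
  obtain ⟨n, hn⟩ := hpeven
  obtain ⟨m, rfl⟩ : ∃ m, n = m + 2 := ⟨n - 2, by omega⟩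
  obtain rfl : p = 2 * (m + 2) := by omega
  have hm : MeasurableSet (periodCell d) := (isCompact_periodCell d).isClosed.measurableSet
  have hfm : IsFiniteMeasure (volume.restrict (periodCell d)) :=
    ⟨by simpa using (isCompact_periodCell d).measure_lt_top⟩
  have hc := const_nonneg d α hα
  obtain ⟨L₁, hL₁, hlip₁⟩ := periodic_lipschitz d θ hθ hper
  obtain ⟨L₂, hL₂, hlip₂⟩ := periodic_lipschitz d (fun x => θ x ^ (2 * (m + 2) - 1))
    (hθ.pow _) (fun x k => by simp only [latV, hper x k])
  have hGc : Continuous (fun q : EuclideanSpace ℝ (Fin d) × EuclideanSpace ℝ (Fin d) =>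
      fp (2 * (m + 2)) (θ q.1) (θ q.2)) := by
    have := hθ.continuous
    unfold fp
    fun_prop
  have hGC : ∀ x y k, fp (2 * (m + 2)) (θ x) (θ y) ≤
      (((2 * (m + 2) : ℕ) : ℝ) * (L₂ * L₁)) * ‖x - y - latV d k‖ ^ 2 := by
    intro x y k
    have hy : θ (y + latV d k) = θ y := hper y k
    have h1 := hlip₁ x (y + latV d k)
    have h2 := hlip₂ x (y + latV d k)
    simp only [hy, ← sub_sub] at h1 h2
    have h3 : (θ x ^ (2 * (m + 2) - 1) - θ y ^ (2 * (m + 2) - 1)) * (θ x - θ y) ≤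
        (L₂ * ‖x - y - latV d k‖) * (L₁ * ‖x - y - latV d k‖) := by
      refine (le_abs_self _).trans ?_
      rw [abs_mul]
      exact mul_le_mul h2 h1 (abs_nonneg _) (by positivity)
    have h4 := mul_le_mul_of_nonneg_left h3 (Nat.cast_nonneg (α := ℝ) (2 * (m + 2)))
    unfold fp
    nlinarith [sq_nonneg (θ x ^ (2 * (m + 2) / 2) - θ y ^ (2 * (m + 2) / 2))]
  have hFint := integrable_main d hd α hα (fun x y => fp (2 * (m + 2)) (θ x) (θ y)) hGc
    (fun x y => fp_nonneg' m _ _) _ hGC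
  have hdpos : 0 < (d : ℝ) := by exact_mod_cast hd
  set E : ℝ := (2 * π + 2 * π * √d) ^ ((d : ℝ) + α) with hE
  have hEpos : 0 < E := by positivity
  have hrd : -((d : ℝ) + α) < -(d : ℝ) := by have := hα.1; linarith
  have hrneg : -((d : ℝ) + α) < 0 := hrd.trans_le (by simp)
  have hpt : ∀ x ∈ periodCell d, ∀ y ∈ periodCell d,
      fp (2 * (m + 2)) (θ x) (θ y) * (fracLapConstD d α * E⁻¹) ≤
        fp (2 * (m + 2)) (θ x) (θ y) * periodicKernelD d α (x - y) := by
    intro x hx y hy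
    by_cases hxy : x = y
    · subst hxy
      simp [fp]
    · refine mul_le_mul_of_nonneg_left ?_ (fp_nonneg' m _ _)
      unfold periodicKernelD
      refine mul_le_mul_of_nonneg_left ?_ hc
      refine le_trans ?_ ((summable_shift d _ hrd (x - y)).le_tsum 0 fun k _ => by positivity)
      have h0 : latV d 0 = 0 := by ext i; simp [latV]
      rw [h0, sub_zero, hE, ← Real.rpow_neg (by positivity)]
      have := norm_sub_cell d hx hy
      exact Real.rpow_le_rpow_of_nonpos (norm_pos_iff.2 (sub_ne_zero.2 hxy))
        (by linarith [Real.pi_pos]) hrneg.le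
  have hcont2 : ∀ x, Integrable (fun y => fp (2 * (m + 2)) (θ x) (θ y))
      (volume.restrict (periodCell d)) := fun x =>
    ((hGc.comp (Continuous.prodMk_right x)).continuousOn).integrableOn_compact
      (isCompact_periodCell d)
  have hprod : Integrable (fun q : EuclideanSpace ℝ (Fin d) × EuclideanSpace ℝ (Fin d) =>
      fp (2 * (m + 2)) (θ q.1) (θ q.2))
      ((volume.restrict (periodCell d)).prod (volume.restrict (periodCell d))) := by
    rw [Measure.prod_restrict]
    exact hGc.continuousOn.integrableOn_compact
      ((isCompact_periodCell d).prod (isCompact_periodCell d))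
  have hlow : (∫ x in periodCell d, (∫ y in periodCell d,
        fp (2 * (m + 2)) (θ x) (θ y)) * (fracLapConstD d α * E⁻¹)) ≤
      ∫ x in periodCell d, (∫ y in periodCell d,
        fp (2 * (m + 2)) (θ x) (θ y) * periodicKernelD d α (x - y)) := by
    refine integral_mono_ae (hprod.integral_prod_left.mul_const _) hFint.integral_prod_left ?_
    filter_upwards [ae_restrict_mem hm, hFint.prod_right_ae] with x hx hxi
    rw [← integral_mul_const]
    refine integral_mono_ae ((hcont2 x).mul_const _) hxi ?_
    filter_upwards [ae_restrict_mem hm] with y hy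
    exact hpt x hx y hy
  rw [integral_mul_const] at hlow
  refine ge_trans hlow ?_
  have hd2 := double_integral_bound d m θ hθ.continuous hmean
  have habs : ∀ x, |θ x| ^ (2 * (m + 2)) = θ x ^ (2 * (m + 2)) := fun x =>
    Even.pow_abs (even_two_mul _) _
  simp_rw [habs]
  have hI : 0 ≤ ∫ x in periodCell d, θ x ^ (2 * (m + 2)) :=
    integral_nonneg fun x => by simpa using (even_two_mul (m + 2)).pow_nonneg (θ x)
  have hcE : 0 ≤ fracLapConstD d α * E⁻¹ := by positivity
  refine le_trans ?_ (mul_le_mul_of_nonneg_right hd2 hcE)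
  have hnn : 0 ≤ (2 * (m : ℝ) + 2) * (2 * π) ^ d * (∫ x in periodCell d, θ x ^ (2 * (m + 2))) *
    (fracLapConstD d α * E⁻¹) := by positivity
  have e : (((2 * (m + 2) : ℕ) : ℝ) - 2) * fracLapConstD d α * (2 * π) ^ d / (2 * E) *
      (∫ x in periodCell d, θ x ^ (2 * (m + 2))) =
      1 / 2 * ((2 * (m : ℝ) + 2) * (2 * π) ^ d * (∫ x in periodCell d, θ x ^ (2 * (m + 2))) *
        (fracLapConstD d α * E⁻¹)) := by
    push_cast
    field_simp
    ring
  rw [e]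
  linarith
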